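/- arXiv:0907.2430 — 2 statements merged into one kernel-verified Lean document; each statement's English description precedes it below -/
import Mathlib

section
/- A binary sequence s is balanced if and only if there exists a binary sequence u such that 0·u ≤ T^k(s) ≤ 1·u for all k ≥ 0 (lexicographic order). -/
/-- The finite word `s(i) s(i+1) ⋯ s(i+k−1)`. -/
def window {A : Type*} (s : ℕ → A) (i k : ℕ) : List A :=
  (List.range k).map fun j => s (i + j)

/-- `l` is a factor of the sequence `s`. -/
def IsFactor {A : Type*} (s : ℕ → A) (l : List A) : Prop :=
  ∃ i, l = window s i l.length

/-- The number of distinct factors of `s` of length `k` (complexity function). -/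
noncomputable def complexity {A : Type*} (s : ℕ → A) (k : ℕ) : ℕ :=
  Set.ncard {l : List A | l.length = k ∧ IsFactor s l}

/-- The shift map. -/
def shiftMap {A : Type*} (s : ℕ → A) : ℕ → A := fun n => s (n + 1)

/-- The sequence `x·u`. -/
def pre {A : Type*} (x : A) (u : ℕ → A) : ℕ → A
  | 0 => x
  | n + 1 => u n

/-- Strict lexicographic order on sequences. -/
def SeqLt {A : Type*} [LT A] (u v : ℕ → A) : Prop :=
  ∃ i, (∀ j < i, u j = v j) ∧ u i < v i

/-- Lexicographic order on sequences. -/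
def SeqLe {A : Type*} [LT A] (u v : ℕ → A) : Prop :=
  (∀ n, u n = v n) ∨ SeqLt u v

/-- Lexicographic order on (equal-length) finite words. -/
def WordLe {A : Type*} [LT A] (u v : List A) : Prop :=
  u = v ∨ List.Lex (· < ·) u v

def UltimatelyPeriodic {A : Type*} (s : ℕ → A) : Prop :=
  ∃ N, ∃ q ≥ 1, ∀ n ≥ N, s (n + q) = s n

/-- A binary sequence is Sturmian if it has complexity `k + 1` for all `k ≥ 1`. -/
def Sturmian (s : ℕ → Fin 2) : Prop :=
  ∀ k ≥ 1, complexity s k = k + 1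

/-- `w` is a left special factor of `s`. -/
def LeftSpecial {A : Type*} (s : ℕ → A) (w : List A) : Prop :=
  ∃ x y : A, x ≠ y ∧ IsFactor s (x :: w) ∧ IsFactor s (y :: w)

/-- A binary sequence is balanced. -/
def BalancedSeq (s : ℕ → Fin 2) : Prop :=
  ∀ u v : List (Fin 2), IsFactor s u → IsFactor s v → u.length = v.length →
    ((u.count 1 : ℤ) - (v.count 1 : ℤ)).natAbs ≤ 1

/-- `u` is the characteristic Sturmian sequence of slope `α`. -/
def IsCharSturmian (α : ℝ) (u : ℕ → Fin 2) : Prop :=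
  ∀ n : ℕ, ((u n : ℕ) : ℤ) = ⌊((n : ℝ) + 2) * α⌋ - ⌊((n : ℝ) + 1) * α⌋

theorem shift_iter (s : ℕ → Fin 2) (k n : ℕ) : (shiftMap^[k] s) n = s (k + n) := by
  induction k generalizing n with
  | zero => simp
  | succ k ih =>
    rw [Function.iterate_succ_apply']
    show (shiftMap^[k] s) (n+1) = _
    rw [ih]; congr 1; omega

theorem win_len (s : ℕ → Fin 2) (i k : ℕ) : (window s i k).length = k := by
  simp [window]

theorem win_factor (s : ℕ → Fin 2) (i k : ℕ) : IsFactor s (window s i k) :=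
  ⟨i, by rw [win_len]⟩

theorem win_count_succ (s : ℕ → Fin 2) (i k : ℕ) :
    (window s i (k+1)).count 1 = (window s i k).count 1 + (s (i+k)).val := by
  unfold window
  rw [List.range_succ, List.map_append, List.count_append]
  congr 1
  generalize hx : s (i+k) = x
  have : x = 0 ∨ x = 1 := by omega
  rcases this with h | h <;> simp [hx, h]

theorem win_count_zero (s : ℕ → Fin 2) (i : ℕ) : (window s i 0).count 1 = 0 := by
  simp [window]

def Conflict (s : ℕ → Fin 2) : Prop :=
  ∃ i j m, s i = 1 ∧ s j = 0 ∧ (∀ t < m, s (i+1+t) = s (j+1+t)) ∧ s (i+1+m) = 1 ∧ s (j+1+m) = 0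

theorem fin2 (x : Fin 2) : (x = 0 ∧ x.val = 0) ∨ (x = 1 ∧ x.val = 1) := by omega

theorem bal_of_no (s : ℕ → Fin 2) (h : ¬ Conflict s) (i j n : ℕ) :
    (window s i n).count 1 ≤ (window s j n).count 1 ∨
    ((window s i n).count 1 = (window s j n).count 1 + 1 ∧
      ∃ q < n, s (i+q) = 1 ∧ s (j+q) = 0 ∧ ∀ t, q < t → t < n → s (i+t) = s (j+t)) := by
  induction n with
  | zero => left; simp [win_count_zero]
  | succ n ih =>
    rw [win_count_succ, win_count_succ]
    rcases ih with ih | ⟨ih, q, hq, h1, h0, he⟩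
    · rcases fin2 (s (i+n)) with ⟨a, b⟩ | ⟨a, b⟩ <;> rcases fin2 (s (j+n)) with ⟨c, d⟩ | ⟨c, d⟩
      · left; omega
      · left; omega
      · by_cases hh : (window s i n).count 1 = (window s j n).count 1
        · right
          exact ⟨by omega, n, by omega, a, c, fun t _ _ => by omega⟩
        · left; omega
      · left; omega
    · have key : s (i+n) = s (j+n) → ∀ t, q < t → t < n+1 → s (i+t) = s (j+t) := by
        intro e t ht ht'
        rcases Nat.lt_succ_iff_lt_or_eq.mp ht' with h | rfl
        · exact he t ht h
        · exact e
      rcases fin2 (s (i+n)) with ⟨a, b⟩ | ⟨a, b⟩ <;> rcases fin2 (s (j+n)) with ⟨c, d⟩ | ⟨c, d⟩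
      · right; exact ⟨by omega, q, by omega, h1, h0, key (by rw [a, c])⟩
      · left; omega
      · exfalso
        apply h
        refine ⟨i+q, j+q, n-q-1, h1, h0, ?_, ?_, ?_⟩
        · intro t ht
          have := he (q+1+t) (by omega) (by omega)
          rw [show i+q+1+t = i+(q+1+t) by omega, show j+q+1+t = j+(q+1+t) by omega, this]
        · rw [show i+q+1+(n-q-1) = i+n by omega, a]
        · rw [show j+q+1+(n-q-1) = j+n by omega, c]
      · right; exact ⟨by omega, q, by omega, h1, h0, key (by rw [a, c])⟩

theorem no_of_bal (s : ℕ → Fin 2) (hb : BalancedSeq s) : ¬ Conflict s := by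
  rintro ⟨i, j, m, h1, h0, he, g1, g0⟩
  have key : ∀ n ≤ m, (window s i (n+1)).count 1 = (window s j (n+1)).count 1 + 1 := by
    intro n
    induction n with
    | zero => intro _; simp [win_count_succ, win_count_zero, h1, h0]
    | succ n ih =>
      intro hn
      have e := he n (by omega)
      rw [win_count_succ s i (n+1), win_count_succ s j (n+1), ih (by omega),
        show i+(n+1) = i+1+n by omega, show j+(n+1) = j+1+n by omega, e]
      omega
  have k := key m le_rfl
  have b := hb _ _ (win_factor s i (m+1+1)) (win_factor s j (m+1+1)) (by simp [win_len])
  rw [win_count_succ s i (m+1), win_count_succ s j (m+1), k,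
    show i+(m+1) = i+1+m by omega, show j+(m+1) = j+1+m by omega, g1, g0] at b
  simp at b
  omega

theorem bal_iff (s : ℕ → Fin 2) : BalancedSeq s ↔ ¬ Conflict s := by
  refine ⟨no_of_bal s, fun h => ?_⟩
  rintro u v ⟨i, hi⟩ ⟨j, hj⟩ hl
  rw [hi, hj, hl]
  have a := bal_of_no s h i j v.length
  have b := bal_of_no s h j i v.length
  omega

def setA (s : ℕ → Fin 2) : ℕ → Set ℕ
  | 0 => {i | s i = 1}
  | n+1 => {i | i ∈ setA s n ∧ ((∃ k ∈ setA s n, s (k+1+n) = 1) → s (i+1+n) = 1)}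

open Classical in
noncomputable def supU (s : ℕ → Fin 2) (n : ℕ) : Fin 2 :=
  if ∃ k ∈ setA s n, s (k+1+n) = 1 then 1 else 0

theorem mem_setA (s : ℕ → Fin 2) (i n : ℕ) :
    i ∈ setA s n ↔ s i = 1 ∧ ∀ t < n, s (i+1+t) = supU s t := by
  induction n with
  | zero => simp [setA]
  | succ n ih =>
    have e : i ∈ setA s (n+1) ↔ i ∈ setA s n ∧ s (i+1+n) = supU s n := by
      show (i ∈ setA s n ∧ _) ↔ _
      refine and_congr_right fun hi => ?_
      unfold supU
      split_ifs with hh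
      · simp [hh]
      · have : ¬ s (i+1+n) = 1 := fun h => hh ⟨i, hi, h⟩
        simp only [hh, false_imp_iff, true_iff]
        omega
    rw [e, ih, and_assoc]
    refine and_congr_right fun _ => ?_
    constructor
    · rintro ⟨a, b⟩ t ht
      rcases Nat.lt_succ_iff_lt_or_eq.mp ht with h | rfl
      · exact a t h
      · exact b
    · intro a
      exact ⟨fun t ht => a t (by omega), a n (by omega)⟩

theorem first_diff (u v : ℕ → Fin 2) :
    (∀ n, u n = v n) ∨ ∃ n, (∀ t < n, u t = v t) ∧ u n ≠ v n := by
  classical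
  by_cases h : ∀ n, u n = v n
  · exact Or.inl h
  · right
    push Not at h
    exact ⟨Nat.find h, fun t ht => not_not.mp (Nat.find_min h ht), Nat.find_spec h⟩

theorem seqLe_pre_left (u v : ℕ → Fin 2) (x : Fin 2) (h0 : v 0 = x) :
    SeqLe (pre x u) v ↔ SeqLe u (fun n => v (n+1)) := by
  unfold SeqLe SeqLt
  refine or_congr ⟨fun h n => h (n+1), fun h n => ?_⟩ ⟨?_, ?_⟩
  · cases n with
    | zero => exact h0.symm
    | succ n => exact h n
  · rintro ⟨i, a, b⟩
    cases i with
    | zero => simp [pre, h0] at b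
    | succ i => exact ⟨i, fun t ht => a (t+1) (by omega), b⟩
  · rintro ⟨i, a, b⟩
    refine ⟨i+1, fun t ht => ?_, b⟩
    cases t with
    | zero => exact h0.symm
    | succ n => exact a n (by omega)

theorem seqLe_pre_right (u v : ℕ → Fin 2) (x : Fin 2) (h0 : v 0 = x) :
    SeqLe v (pre x u) ↔ SeqLe (fun n => v (n+1)) u := by
  unfold SeqLe SeqLt
  refine or_congr ⟨fun h n => h (n+1), fun h n => ?_⟩ ⟨?_, ?_⟩
  · cases n with
    | zero => exact h0
    | succ n => exact h n
  · rintro ⟨i, a, b⟩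
    cases i with
    | zero => simp [pre, h0] at b
    | succ i => exact ⟨i, fun t ht => a (t+1) (by omega), b⟩
  · rintro ⟨i, a, b⟩
    refine ⟨i+1, fun t ht => ?_, b⟩
    cases t with
    | zero => exact h0
    | succ n => exact a n (by omega)

theorem exists_u (s : ℕ → Fin 2) (h : ¬ Conflict s) (k : ℕ) :
    SeqLe (pre 0 (supU s)) (shiftMap^[k] s) ∧ SeqLe (shiftMap^[k] s) (pre 1 (supU s)) := by
  have e : shiftMap^[k] s = fun n => s (k+n) := funext (shift_iter s k)
  rw [e]
  rcases fin2 (s k) with ⟨a, -⟩ | ⟨a, -⟩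
  · refine ⟨?_, Or.inr ⟨0, by simp, by simp [pre, a]⟩⟩
    rw [seqLe_pre_left _ _ _ (by simpa using a)]
    rcases first_diff (supU s) (fun n => s (k+(n+1))) with h' | ⟨n, b, c⟩
    · exact Or.inl h'
    · refine Or.inr ⟨n, b, ?_⟩
      rcases fin2 (supU s n) with ⟨d, -⟩ | ⟨d, -⟩
      · simp only [d] at c ⊢; omega
      · exfalso
        have d' := d
        unfold supU at d'
        split_ifs at d' with hh
        · obtain ⟨i, hi, hi1⟩ := hh
          rw [mem_setA] at hi
          apply h
          refine ⟨i, k, n, hi.1, a, fun t ht => ?_, hi1, ?_⟩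
          · rw [hi.2 t ht, b t ht]; congr 1; omega
          · rw [show k+1+n = k+(n+1) by omega]; simp only [d] at c; omega
        · simp at d'
  · refine ⟨Or.inr ⟨0, by simp, by simp [pre, a]⟩, ?_⟩
    rw [seqLe_pre_right _ _ _ (by simpa using a)]
    rcases first_diff (fun n => s (k+(n+1))) (supU s) with h' | ⟨n, b, c⟩
    · exact Or.inl h'
    · refine Or.inr ⟨n, b, ?_⟩
      have hk : k ∈ setA s n := (mem_setA s k n).2 ⟨a, fun t ht => by
        rw [← b t ht]; congr 1; omega⟩
      rcases fin2 (s (k+(n+1))) with ⟨d, -⟩ | ⟨d, -⟩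
      · simp only [d] at c ⊢; omega
      · exfalso
        apply c
        have : ∃ i ∈ setA s n, s (i+1+n) = 1 :=
          ⟨k, hk, by rw [show k+1+n = k+(n+1) by omega, d]⟩
        simp only [supU, if_pos this, d]

theorem no_of_u (s u : ℕ → Fin 2) (hu : ∀ k : ℕ,
    SeqLe (pre 0 u) (shiftMap^[k] s) ∧ SeqLe (shiftMap^[k] s) (pre 1 u)) : ¬ Conflict s := by
  rintro ⟨i, j, m, h1, h0, he, g1, g0⟩
  have A := (hu i).2
  have B := (hu j).1
  rw [funext (shift_iter s i), seqLe_pre_right _ _ _ (by simpa using h1)] at A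
  rw [funext (shift_iter s j), seqLe_pre_left _ _ _ (by simpa using h0)] at B
  have A' : SeqLe (fun n => s (i+1+n)) u := by
    convert A using 3; omega
  have B' : SeqLe u (fun n => s (j+1+n)) := by
    convert B using 3; omega
  generalize hf : (fun n => s (i+1+n)) = f at A'
  generalize hg : (fun n => s (j+1+n)) = g at B'
  have he' : ∀ t < m, f t = g t := by subst hf hg; exact he
  have hf1 : f m = 1 := by subst hf; exact g1
  have hg0 : g m = 0 := by subst hg; exact g0
  clear A B
  rcases A' with A | ⟨p, A, A1⟩ <;> rcases B' with B | ⟨q, B, B1⟩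
  · have := A m; have := B m; omega
  · rcases lt_trichotomy q m with h | h | h
    · have := he' q h; have := A q; omega
    · subst h; have := A q; omega
    · have := A m; have := B m h; omega
  · rcases lt_trichotomy p m with h | h | h
    · have := he' p h; have := B p; omega
    · subst h; have := B p; omega
    · have := B m; have := A m h; omega
  · rcases lt_trichotomy p q with h | h | h
    · have := B p h
      rcases lt_trichotomy p m with h' | h' | h'
      · have := he' p h'; omega
      · subst h'; omega
      · have := A m h'; have := B m (by omega); omega
    · subst h
      rcases lt_trichotomy p m with h' | h' | h'
      · have := he' p h'; omega
      · subst h'; omega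
      · have := A m h'; have := B m (by omega); omega
    · have := A q h
      rcases lt_trichotomy q m with h' | h' | h'
      · have := he' q h'; omega
      · subst h'; omega
      · have := B m h'; have := A m (by omega); omega

/-- A binary sequence is balanced iff there is a sequence `u` with
`0·u ≤ Tᵏ(s) ≤ 1·u` for all `k ≥ 0`. -/
theorem stmt12 (s : ℕ → Fin 2) :
    BalancedSeq s ↔
      ∃ u : ℕ → Fin 2, ∀ k : ℕ,
        SeqLe (pre 0 u) (shiftMap^[k] s) ∧ SeqLe (shiftMap^[k] s) (pre 1 u) := by
  rw [bal_iff]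
  exact ⟨fun h => ⟨supU s, exists_u s h⟩, fun ⟨u, hu⟩ => no_of_u s u hu⟩
end

section
/- For a binary sequence t, the following are equivalent: (a) t is fine, i.e., there exists a binary sequence u such that for every k ≥ 1 the length-k prefix of 0·u is a factor of t and is lexicographically ≤ every factor of t of length k, and the length-k prefix of 1·u is a factor of t and is lexicographically ≥ every factor of t of length k (that is, min(t) = 0·u and max(t) = 1·u); (b) t is balanced and t is not purely periodic (equivalently, t is either Sturmian or a skew word). -/
theorem window_succ {A : Type*} (s : ℕ → A) (i k : ℕ) :
    window s i (k+1) = s i :: window s (i+1) k := by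
  unfold window
  rw [List.range_succ_eq_map]
  simp only [List.map_cons, List.map_map, Nat.add_zero]
  congr 1
  apply List.map_congr_left
  intro a _
  simp only [Function.comp, Nat.succ_eq_add_one]
  congr 1
  omega

theorem window_length {A : Type*} (s : ℕ → A) (i k : ℕ) : (window s i k).length = k := by
  simp [window]

theorem window_eq_iff {A : Type*} (a b : ℕ → A) (i j k : ℕ) :
    window a i k = window b j k ↔ ∀ m < k, a (i+m) = b (j+m) := by
  simp [window]

theorem wordLe_iff (a b : ℕ → Fin 2) (k : ℕ) : ∀ i j,
    WordLe (window a i k) (window b j k) ↔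
      ∀ n < k, (∀ m < n, a (i+m) = b (j+m)) → a (i+n) ≤ b (j+n) := by
  induction k with
  | zero => intro i j; simp [window, WordLe]
  | succ k ih =>
    intro i j
    have ih' := ih (i+1) (j+1)
    have key : WordLe (window a i (k+1)) (window b j (k+1)) ↔
        a i < b j ∨ (a i = b j ∧ WordLe (window a (i+1) k) (window b (j+1) k)) := by
      rw [window_succ, window_succ]
      unfold WordLe
      rw [List.cons_lex_cons_iff, List.cons.injEq]
      tauto
    rw [key, ih']
    constructor
    · rintro (h | ⟨h, h2⟩) n hn hm
      · rcases n with _ | n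
        · exact h.le
        · have := hm 0 (by omega)
          simp only [Nat.add_zero] at this
          exact absurd this h.ne
      · rcases n with _ | n
        · exact h.le
        · have := h2 n (by omega) (fun m hmn => by
            have := hm (m+1) (by omega)
            rwa [show i+(m+1) = i+1+m by omega, show j+(m+1) = j+1+m by omega] at this)
          rwa [show i+(n+1) = i+1+n by omega, show j+(n+1) = j+1+n by omega]
    · intro h
      have h0 := h 0 (by omega) (by intro m hm; omega)
      simp only [Nat.add_zero] at h0
      rcases h0.lt_or_eq with h1 | h1
      · exact Or.inl h1
      · refine Or.inr ⟨h1, fun n hn hm => ?_⟩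
        have := h (n+1) (by omega) (fun m hmn => by
          rcases m with _ | m
          · exact h1
          · have := hm m (by omega)
            rwa [show i+(m+1) = i+1+m by omega, show j+(m+1) = j+1+m by omega])
        rwa [show i+(n+1) = i+1+n by omega, show j+(n+1) = j+1+n by omega] at this

def Bad (t : ℕ → Fin 2) : Prop := ∃ i j n, t i = 0 ∧ t j = 1 ∧
  (∀ m < n, t (i+1+m) = t (j+1+m)) ∧ t (i+1+n) = 0 ∧ t (j+1+n) = 1

def SS (t : ℕ → Fin 2) (i k : ℕ) : ℤ := ∑ m ∈ Finset.range k, ((t (i+m)).val : ℤ)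

theorem count_window (t : ℕ → Fin 2) (i k : ℕ) :
    ((window t i k).count 1 : ℤ) = SS t i k := by
  induction k with
  | zero => simp [window, SS]
  | succ k ih =>
    unfold window SS at *
    rw [List.range_succ, Finset.sum_range_succ, List.map_append, List.count_append, ← ih]
    have : t (i+k) = 0 ∨ t (i+k) = 1 := by
      generalize t (i+k) = x; revert x; decide
    rcases this with h | h <;> simp [h]

theorem SS_succ (t : ℕ → Fin 2) (i k : ℕ) : SS t i (k+1) = SS t i k + ((t (i+k)).val : ℤ) := by
  simp [SS, Finset.sum_range_succ]

theorem SS_add (t : ℕ → Fin 2) (i k l : ℕ) : SS t i (k+l) = SS t i k + SS t (i+k) l := by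
  simp [SS, Finset.sum_range_add, Nat.add_assoc]

theorem SS_congr (t : ℕ → Fin 2) (i j k : ℕ) (h : ∀ m < k, t (i+m) = t (j+m)) :
    SS t i k = SS t j k := by
  unfold SS
  apply Finset.sum_congr rfl
  intro m hm
  rw [h m (Finset.mem_range.mp hm)]

theorem balanced_iff_SS (t : ℕ → Fin 2) :
    BalancedSeq t ↔ ∀ i j k, SS t j k ≤ SS t i k + 1 := by
  constructor
  · intro h i j k
    have := h (window t i k) (window t j k) ⟨i, by rw [window_length]⟩
      ⟨j, by rw [window_length]⟩ (by simp [window_length])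
    rw [count_window, count_window] at this
    omega
  · rintro h u v ⟨i, hi⟩ ⟨j, hj⟩ hl
    rw [hi, hj, count_window, count_window, hl]
    have h1 := h i j v.length
    have h2 := h j i v.length
    omega

theorem val_bd (x : Fin 2) : (0:ℤ) ≤ x.val ∧ (x.val : ℤ) ≤ 1 := by
  have := x.isLt; omega

theorem balanced_iff (t : ℕ → Fin 2) : BalancedSeq t ↔ ¬ Bad t := by
  rw [balanced_iff_SS]
  constructor
  · rintro h ⟨i, j, n, h1, h2, h3, h4, h5⟩
    have hi := SS_add t i 1 (n+1)
    have hj := SS_add t j 1 (n+1)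
    rw [SS_succ t (i+1) n, h4] at hi
    rw [SS_succ t (j+1) n, h5] at hj
    have := SS_congr t _ _ _ h3
    have e := h i j (1+(n+1))
    have e1 : SS t i 1 = 0 := by simp [SS, h1]
    have e2 : SS t j 1 = 1 := by simp [SS, h2]
    simp at hi hj
    omega
  · intro hB
    by_contra hc
    push Not at hc
    apply hB
    have hex : ∃ k, ∃ i j, SS t i k + 1 < SS t j k := by
      obtain ⟨i, j, k, h⟩ := hc; exact ⟨k, i, j, h⟩
    classical
    obtain ⟨i, j, hk⟩ := Nat.find_spec hex
    have hmin := fun l (hl : l < Nat.find hex) => Nat.find_min hex hl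
    generalize Nat.find hex = k at hk hmin
    push Not at hmin
    have z : ∀ i, SS t i 0 = 0 := fun i => by simp [SS]
    have b := fun m => val_bd (t m)
    have mid : ∀ m, 0 < m → m < k → SS t j m = SS t i m + 1 ∧ SS t j k = SS t i k + 2 := by
      intro m h0 hm
      have e1 := hmin m hm i j
      have e2 := hmin (k-m) (by omega) (i+m) (j+m)
      have a1 := SS_add t i m (k-m)
      have a2 := SS_add t j m (k-m)
      rw [show m+(k-m) = k by omega] at a1 a2
      omega
    have hk2 : 2 ≤ k := by
      by_contra hlt
      have : k = 0 ∨ k = 1 := by omega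
      rcases this with h | h <;> subst h
      · rw [z, z] at hk; omega
      · have := SS_succ t i 0
        have := SS_succ t j 0
        simp only [z, Nat.add_zero, Nat.zero_add] at *
        have := b i; have := b j
        omega
    obtain ⟨n, rfl⟩ : ∃ n, k = n + 2 := ⟨k-2, by omega⟩
    refine ⟨i, j, n, ?_⟩
    have m1 := mid 1 (by omega) (by omega)
    have s1 := SS_succ t i 0
    have s2 := SS_succ t j 0
    rw [z] at s1 s2
    simp only [Nat.zero_add, Nat.add_zero] at s1 s2
    have ml := mid (n+1) (by omega) (by omega)
    have s3 : SS t i (n+2) = _ := SS_succ t i (n+1)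
    have s4 : SS t j (n+2) = _ := SS_succ t j (n+1)
    have b1 := b i
    have b2 := b j
    have b3 := b (i+(n+1))
    have b4 := b (j+(n+1))
    rw [show i+1+n = i+(n+1) by omega, show j+1+n = j+(n+1) by omega]
    refine ⟨?_, ?_, ?_, ?_, ?_⟩
    · apply Fin.ext; simp; omega
    · apply Fin.ext; simp; omega
    · intro m hm
      have c1 := mid (m+1) (by omega) (by omega)
      have c2 := mid (m+1+1) (by omega) (by omega)
      have s5 := SS_succ t i (m+1)
      have s6 := SS_succ t j (m+1)
      rw [show i+1+m = i+(m+1) by omega, show j+1+m = j+(m+1) by omega]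
      apply Fin.ext; omega
    · apply Fin.ext; simp; omega
    · apply Fin.ext; simp; omega

def FineBy (t u : ℕ → Fin 2) : Prop :=
  (∀ k, ∃ i, t i = 0 ∧ ∀ m < k, t (i+1+m) = u m) ∧
  (∀ k, ∃ i, t i = 1 ∧ ∀ m < k, t (i+1+m) = u m) ∧
  (∀ i p, t i = 0 → (∀ m < p, u m = t (i+1+m)) → u p ≤ t (i+1+p)) ∧
  (∀ i p, t i = 1 → (∀ m < p, t (i+1+m) = u m) → t (i+1+p) ≤ u p)

theorem isFactor_pre (t u : ℕ → Fin 2) (x : Fin 2) (k : ℕ) :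
    IsFactor t (window (pre x u) 0 (k+1)) ↔ ∃ i, t i = x ∧ ∀ m < k, t (i+1+m) = u m := by
  unfold IsFactor
  rw [window_length]
  apply exists_congr
  intro i
  rw [window_eq_iff]
  constructor
  · intro h
    refine ⟨(h 0 (by omega)).symm, fun m hm => ?_⟩
    have := h (m+1) (by omega)
    rw [show i+(m+1) = i+1+m by omega, Nat.zero_add] at this
    exact this.symm
  · rintro ⟨h, h2⟩ m hm
    rcases m with _ | m
    · exact h.symm
    · rw [show i+(m+1) = i+1+m by omega, Nat.zero_add, h2 m (by omega)]
      rfl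

theorem fine_iff (t u : ℕ → Fin 2) :
    (∀ k ≥ 1,
        (IsFactor t (window (pre 0 u) 0 k) ∧
          ∀ w : List (Fin 2), w.length = k → IsFactor t w →
            WordLe (window (pre 0 u) 0 k) w) ∧
        (IsFactor t (window (pre 1 u) 0 k) ∧
          ∀ w : List (Fin 2), w.length = k → IsFactor t w →
            WordLe w (window (pre 1 u) 0 k))) ↔ FineBy t u := by
  constructor
  · intro h
    refine ⟨fun k => ?_, fun k => ?_, fun i p h0 hm => ?_, fun i p h0 hm => ?_⟩
    · exact (isFactor_pre t u 0 k).1 (h (k+1) (by omega)).1.1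
    · exact (isFactor_pre t u 1 k).1 (h (k+1) (by omega)).2.1
    · have := (h (p+2) (by omega)).1.2 (window t i (p+2)) (window_length _ _ _)
        ⟨i, by rw [window_length]⟩
      rw [wordLe_iff] at this
      have := this (p+1) (by omega) (by
        intro m hmp
        rcases m with _ | m
        · exact h0.symm
        · rw [show i+(m+1) = i+1+m by omega, Nat.zero_add, ← hm m (by omega)]
          rfl)
      rw [show i+(p+1) = i+1+p by omega, Nat.zero_add] at this
      exact this
    · have := (h (p+2) (by omega)).2.2 (window t i (p+2)) (window_length _ _ _)
        ⟨i, by rw [window_length]⟩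
      rw [wordLe_iff] at this
      have := this (p+1) (by omega) (by
        intro m hmp
        rcases m with _ | m
        · exact h0
        · rw [show i+(m+1) = i+1+m by omega, Nat.zero_add, hm m (by omega)]
          rfl)
      rw [show i+(p+1) = i+1+p by omega, Nat.zero_add] at this
      exact this
  · rintro ⟨f0, f1, g0, g1⟩ k hk
    obtain ⟨k, rfl⟩ : ∃ l, k = l + 1 := ⟨k-1, by omega⟩
    refine ⟨⟨(isFactor_pre t u 0 k).2 (f0 k), ?_⟩, ⟨(isFactor_pre t u 1 k).2 (f1 k), ?_⟩⟩
    · rintro w hw ⟨i, hi⟩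
      rw [hi, hw, wordLe_iff]
      intro n hn hm
      rcases n with _ | n
      · exact Fin.zero_le _
      · have := g0 i n (hm 0 (by omega)).symm (fun m hmn => by
          have := hm (m+1) (by omega)
          rw [show i+(m+1) = i+1+m by omega, Nat.zero_add] at this
          exact this)
        rw [show i+(n+1) = i+1+n by omega, Nat.zero_add]
        exact this
    · rintro w hw ⟨i, hi⟩
      rw [hi, hw, wordLe_iff]
      intro n hn hm
      rcases n with _ | n
      · exact Fin.le_last _
      · have := g1 i n (hm 0 (by omega)) (fun m hmn => by
          have := hm (m+1) (by omega)
          rw [show i+(m+1) = i+1+m by omega, Nat.zero_add] at this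
          exact this)
        rw [show i+(n+1) = i+1+n by omega, Nat.zero_add]
        exact this

theorem fin2_cases (x : Fin 2) : x = 0 ∨ x = 1 := by revert x; decide

theorem fine_not_bad (t u : ℕ → Fin 2) (h : FineBy t u) : ¬ Bad t := by
  obtain ⟨f0, f1, g0, g1⟩ := h
  rintro ⟨i, j, n, h1, h2, h3, h4, h5⟩
  have key : ∀ m, m < n → u m = t (i+1+m) := by
    intro m
    induction m using Nat.strong_induction_on with
    | _ m ih =>
      intro hm
      apply le_antisymm
      · exact g0 i m h1 (fun l hl => ih l hl (by omega))
      · rw [h3 m hm]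
        exact g1 j m h2 (fun l hl => by rw [← h3 l (by omega), ih l hl (by omega)])
  have a := g0 i n h1 key
  have b := g1 j n h2 (fun l hl => by rw [← h3 l hl, key l hl])
  rw [h4] at a
  rw [h5] at b
  exact absurd (b.trans a) (by decide)

theorem fine_not_per (t u : ℕ → Fin 2) (h : FineBy t u) :
    ¬ ∃ q ≥ 1, ∀ n : ℕ, t (n + q) = t n := by
  obtain ⟨f0, f1, g0, g1⟩ := h
  rintro ⟨q, hq, hp⟩
  obtain ⟨i, hi, hi2⟩ := f0 q
  obtain ⟨j, hj, hj2⟩ := f1 q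
  have a := hi2 (q-1) (by omega)
  have b := hj2 (q-1) (by omega)
  rw [show i+1+(q-1) = i+q by omega, hp, hi] at a
  rw [show j+1+(q-1) = j+q by omega, hp, hj] at b
  rw [← b] at a
  exact absurd a (by decide)

theorem exists_special (t : ℕ → Fin 2) (hp : ¬ ∃ q ≥ 1, ∀ n : ℕ, t (n + q) = t n) (n : ℕ) :
    ∃ i j, t i = 0 ∧ t j = 1 ∧ ∀ m < n, t (i+1+m) = t (j+1+m) := by
  by_contra hc
  push Not at hc
  have det : ∀ i j, (∀ m < n, t (i+1+m) = t (j+1+m)) → t i = t j := by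
    intro i j h
    rcases fin2_cases (t i) with a | a <;> rcases fin2_cases (t j) with b | b
    · rw [a, b]
    · obtain ⟨m, hm, h'⟩ := hc i j a b; exact absurd (h m hm) h'
    · obtain ⟨m, hm, h'⟩ := hc j i b a; exact absurd (h m hm).symm h'
    · rw [a, b]
  have back : ∀ d i j, (∀ m < n, t (i+d+m) = t (j+d+m)) → ∀ m < n + d, t (i+m) = t (j+m) := by
    intro d
    induction d with
    | zero => intro i j h m hm; exact h m hm
    | succ d ih =>
      intro i j h m hm
      have h' := ih (i+1) (j+1) (fun m hm => by
        have := h m hm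
        rwa [show i+(d+1)+m = i+1+d+m by omega, show j+(d+1)+m = j+1+d+m by omega] at this)
      rcases m with _ | m
      · exact det i j (fun m hm => h' m (by omega))
      · have := h' m (by omega)
        rwa [show i+(m+1) = i+1+m by omega, show j+(m+1) = j+1+m by omega]
  push Not at hp
  let N := Fintype.card (Fin n → Fin 2)
  have hp' : ∀ q, ∃ m, q ≥ 1 → t (m+q) ≠ t m := by
    intro q
    by_cases hq : q ≥ 1
    · obtain ⟨m, hm⟩ := hp q hq; exact ⟨m, fun _ => hm⟩
    · exact ⟨0, fun h => absurd h hq⟩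
  choose F hF using hp'
  let M := ∑ q ∈ Finset.range (N+1), F q
  have hM : ∀ q < N+1, F q ≤ M := fun q hq =>
    Finset.single_le_sum (f := F) (fun _ _ => Nat.zero_le _) (Finset.mem_range.2 hq)
  obtain ⟨a, b, hab, hW⟩ := Fintype.exists_ne_map_eq_of_card_lt
    (fun (a : Fin (N+1)) => fun (m : Fin n) => t (M + 1 + a.val + m.val)) (by simp [N])
  wlog hlt : a < b generalizing a b
  · exact this b a hab.symm hW.symm (lt_of_le_of_ne (not_lt.1 hlt) hab.symm)
  have hlt' : a.val < b.val := hlt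
  have hb := b.isLt
  have := back (M+1+a.val) 0 (b.val - a.val) (fun m hm => by
    have := congrFun hW ⟨m, hm⟩
    simp only at this
    rwa [show 0 + (M+1+a.val) + m = M+1+a.val+m by omega,
      show b.val - a.val + (M+1+a.val) + m = M+1+b.val+m by omega]) (F (b.val-a.val)) (by
        have := hM (b.val-a.val) (by omega); omega)
  rw [Nat.zero_add, Nat.add_comm (b.val - a.val)] at this
  exact hF (b.val-a.val) (by omega) this.symm

theorem exists_fine (t : ℕ → Fin 2) (hB : ¬ Bad t)
    (hp : ¬ ∃ q ≥ 1, ∀ n : ℕ, t (n + q) = t n) : ∃ u, FineBy t u := by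
  choose I J hI hJ hIJ using exists_special t hp
  have uniq : ∀ n n' m, m < n → m < n' → t (I n+1+m) = t (I n'+1+m) := by
    intro n n' m
    induction m using Nat.strong_induction_on with
    | _ m ih =>
      intro h1 h2
      have ih' : ∀ l < m, t (I n+1+l) = t (I n'+1+l) :=
        fun l hl => ih l hl (by omega) (by omega)
      rcases fin2_cases (t (I n+1+m)) with a | a <;> rcases fin2_cases (t (I n'+1+m)) with b | b
      · rw [a, b]
      · exact absurd ⟨I n, J n', m, hI n, hJ n', fun l hl => by
          rw [ih' l hl, hIJ n' l (by omega)], a, by rw [← hIJ n' m h2, b]⟩ hB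
      · exact absurd ⟨I n', J n, m, hI n', hJ n, fun l hl => by
          rw [← ih' l hl, hIJ n l (by omega)], b, by rw [← hIJ n m h1, a]⟩ hB
      · rw [a, b]
  have f0 : ∀ k, ∀ m < k, t (I k+1+m) = t (I (m+1)+1+m) :=
    fun k m hm => uniq _ _ _ hm (by omega)
  have f1 : ∀ k, ∀ m < k, t (J k+1+m) = t (I (m+1)+1+m) :=
    fun k m hm => by rw [← hIJ k m hm]; exact f0 k m hm
  refine ⟨fun n => t (I (n+1)+1+n), fun k => ⟨I k, hI k, f0 k⟩, fun k => ⟨J k, hJ k, f1 k⟩, ?_, ?_⟩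
  · intro i p h0 hm
    by_contra hlt
    apply hB
    simp only [not_le] at hlt hm
    refine ⟨i, J (p+1), p, h0, hJ _, fun m hmp => ?_, ?_, ?_⟩
    · rw [f1 (p+1) m (by omega), hm m hmp]
    · rcases fin2_cases (t (i+1+p)) with a | a
      · exact a
      · rw [a] at hlt; exact absurd hlt (not_lt.2 (Fin.le_last _))
    · rw [f1 (p+1) p (by omega)]
      rcases fin2_cases (t (I (p+1)+1+p)) with a | a
      · rw [a] at hlt; exact absurd hlt (not_lt.2 (Fin.zero_le _))
      · exact a
  · intro i p h0 hm
    by_contra hlt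
    apply hB
    simp only [not_le] at hlt hm
    refine ⟨I (p+1), i, p, hI _, h0, fun m hmp => ?_, ?_, ?_⟩
    · rw [f0 (p+1) m (by omega), hm m hmp]
    · rcases fin2_cases (t (I (p+1)+1+p)) with a | a
      · exact a
      · rw [a] at hlt; exact absurd hlt (not_lt.2 (Fin.le_last _))
    · rcases fin2_cases (t (i+1+p)) with a | a
      · rw [a] at hlt; exact absurd hlt (not_lt.2 (Fin.zero_le _))
      · exact a

/-- A binary sequence `t` is fine (`min(t) = 0·u` and `max(t) = 1·u` for some
sequence `u`) iff `t` is balanced and not purely periodic. -/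
theorem stmt13 (t : ℕ → Fin 2) :
    (∃ u : ℕ → Fin 2, ∀ k ≥ 1,
        (IsFactor t (window (pre 0 u) 0 k) ∧
          ∀ w : List (Fin 2), w.length = k → IsFactor t w →
            WordLe (window (pre 0 u) 0 k) w) ∧
        (IsFactor t (window (pre 1 u) 0 k) ∧
          ∀ w : List (Fin 2), w.length = k → IsFactor t w →
            WordLe w (window (pre 1 u) 0 k))) ↔
    (BalancedSeq t ∧ ¬ ∃ q ≥ 1, ∀ n : ℕ, t (n + q) = t n) := by
  constructor
  · rintro ⟨u, h⟩
    have hf := (fine_iff t u).1 h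
    exact ⟨(balanced_iff t).2 (fine_not_bad t u hf), fine_not_per t u hf⟩
  · rintro ⟨hb, hp⟩
    obtain ⟨u, hu⟩ := exists_fine t ((balanced_iff t).1 hb) hp
    exact ⟨u, (fine_iff t u).2 hu⟩
end
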